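/- arXiv:2502.03204 — 3 statements merged into one kernel-verified Lean document; each statement's English description precedes it below -/
import Mathlib

section
/- Let d ≥ 1. Suppose the data tensor 𝔻 is nonzero and has tensor rank 1, i.e., there are vectors δ⁽ˡ⁾ ∈ ℂ^{N_l} (l = 1, …, d) with 𝔻_{j₁…j_d} = ∏_{l=1}^d δ⁽ˡ⁾_{j_l} for all multi-indices, and 𝔻 has at least one nonzero entry. If there exists a nonzero coefficient tensor α ∈ ℂ^{n₁×⋯×n_d} with L_d vec(α) = 0 (i.e., every entry of the vector L_d vec(α) vanishes), then there exists a nonzero tensor α̃ ∈ ℂ^{n₁×⋯×n_d} of rank at most 1 — that is, α̃_{i₁…i_d} = ∏_{l=1}^d a⁽ˡ⁾_{i_l} for some vectors a⁽ˡ⁾ ∈ ℂ^{n_l} — such that L_d vec(α̃) = 0. -/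
open Classical in
/-- Modified Cauchy vector. -/
noncomputable def modCauchy {n : ℕ} (lam : Fin n → ℂ) (x : ℂ) : Fin n → ℂ :=
  fun i => if x = lam i then 1 else if ∃ j, x = lam j then 0 else (x - lam i)⁻¹

lemma rok_core {d : ℕ} {N n : Fin d → ℕ}
    (A : (l : Fin d) → Fin (N l) → Fin (n l) → ℂ)
    (k : (l : Fin d) → Fin (n l) → Fin (N l))
    (hA : ∀ l i i', A l (k l i) i' = if i = i' then 1 else 0)
    (δ : (l : Fin d) → Fin (N l) → ℂ)
    (hd : 1 ≤ d)
    (α : ((j : Fin d) → Fin (n j)) → ℂ) (hα : α ≠ 0)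
    (hker : ∀ jm : (j : Fin d) → Fin (N j),
      ∑ im : (j : Fin d) → Fin (n j),
        (∏ l, δ l (jm l) - ∏ l, δ l (k l (im l))) * (∏ l, A l (jm l) (im l)) * α im = 0) :
    ∃ a : (l : Fin d) → Fin (n l) → ℂ, (∀ l, a l ≠ 0) ∧
      ∀ jm : (j : Fin d) → Fin (N j),
        ∏ l, (∑ i, δ l (jm l) * A l (jm l) i * a l i)
          = ∏ l, (∑ i, δ l (k l i) * A l (jm l) i * a l i) := by
  classical
  have hne : ∃ i0, α i0 ≠ 0 := by
    by_contra hc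
    push Not at hc
    exact hα (funext hc)
  by_cases hS : ∃ i0, α i0 ≠ 0 ∧ ∀ l, δ l (k l (i0 l)) ≠ 0
  · obtain ⟨i0, h0, hS⟩ := hS
    refine ⟨fun l i => α (Function.update i0 l i), ?_, ?_⟩
    · intro l h
      have := congrFun h (i0 l)
      simp at this
      exact h0 this
    · intro jm
      refine Finset.prod_congr rfl fun l _ => ?_
      have key := hker (Function.update (fun l => k l (i0 l)) l (jm l))
      set c : ℂ := ∏ l' ∈ Finset.univ.erase l, δ l' (k l' (i0 l')) with hc
      have hc0 : c ≠ 0 := Finset.prod_ne_zero_iff.2 fun l' _ => hS l'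
      have e := Fintype.sum_of_injective (fun i : Fin (n l) => Function.update i0 l i)
        (Function.update_injective i0 l)
        (fun i => c * ((δ l (jm l) - δ l (k l i)) * A l (jm l) i * α (Function.update i0 l i)))
        _ ?_ ?_ |>.trans key
      · rw [← Finset.mul_sum] at e
        have e2 := (mul_eq_zero.1 e).resolve_left hc0
        rw [← sub_eq_zero, ← Finset.sum_sub_distrib, ← e2]
        exact Finset.sum_congr rfl fun i _ => by ring
      · intro im him
        have : ∃ l', l' ≠ l ∧ i0 l' ≠ im l' := by
          by_contra hcon
          push Not at hcon
          refine him ⟨im l, ?_⟩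
          funext l'
          by_cases hl : l' = l
          · subst hl; simp
          · simp [hl, hcon l' hl]
        obtain ⟨l', h1, h2⟩ := this
        have hz : (∏ l₁, A l₁ (Function.update (fun l => k l (i0 l)) l (jm l) l₁) (im l₁)) = 0 := by
          refine Finset.prod_eq_zero (Finset.mem_univ l') ?_
          rw [Function.update_of_ne h1, hA, if_neg h2]
        rw [hz]; ring
      · intro i
        have p1 : ∏ l₁, δ l₁ (Function.update (fun l => k l (i0 l)) l (jm l) l₁)
            = δ l (jm l) * c := by
          rw [← Finset.mul_prod_erase _ _ (Finset.mem_univ l), Function.update_self]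
          congr 1
          exact Finset.prod_congr rfl fun l' h => by
            rw [Function.update_of_ne (Finset.ne_of_mem_erase h)]
        have p2 : ∏ l₁, δ l₁ (k l₁ (Function.update i0 l i l₁))
            = δ l (k l i) * c := by
          rw [← Finset.mul_prod_erase _ _ (Finset.mem_univ l), Function.update_self]
          congr 1
          exact Finset.prod_congr rfl fun l' h => by
            rw [Function.update_of_ne (Finset.ne_of_mem_erase h)]
        have p3 : ∏ l₁, A l₁ (Function.update (fun l => k l (i0 l)) l (jm l) l₁)
            (Function.update i0 l i l₁) = A l (jm l) i := by
          rw [← Finset.mul_prod_erase _ _ (Finset.mem_univ l), Function.update_self,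
            Function.update_self, Finset.prod_eq_one, mul_one]
          intro l' h
          rw [Function.update_of_ne (Finset.ne_of_mem_erase h),
            Function.update_of_ne (Finset.ne_of_mem_erase h), hA, if_pos rfl]
        rw [p1, p2, p3]; ring
  · push Not at hS
    have hz : ∀ im, (∏ l, δ l (k l (im l))) * α im = 0 := by
      intro im
      by_cases h : α im = 0
      · simp [h]
      · obtain ⟨l, hl⟩ := hS im h
        rw [Finset.prod_eq_zero (Finset.mem_univ l) hl, zero_mul]
    have hP : ∀ jm : (j : Fin d) → Fin (N j),
        ∑ im : (j : Fin d) → Fin (n j), (∏ l, δ l (jm l) * A l (jm l) (im l)) * α im = 0 := by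
      intro jm
      rw [← hker jm]
      refine Finset.sum_congr rfl fun im _ => ?_
      rw [Finset.prod_mul_distrib]
      linear_combination (∏ l, A l (jm l) (im l)) * hz im
    by_cases hinj : ∀ l, ∀ v : Fin (n l) → ℂ,
        (Matrix.of fun j i => δ l j * A l j i).mulVec v = 0 → v = 0
    · exfalso
      have hB : ∀ l, ∃ B : Matrix (Fin (n l)) (Fin (N l)) ℂ,
          B * (Matrix.of fun j i => δ l j * A l j i) = 1 := by
        intro l
        obtain ⟨g, hg⟩ := LinearMap.exists_leftInverse_of_injective
          (Matrix.toLin' (Matrix.of fun j i => δ l j * A l j i))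
          (LinearMap.ker_eq_bot'.2 fun v hv => hinj l v (by simpa using hv))
        refine ⟨LinearMap.toMatrix' g, ?_⟩
        have := congrArg LinearMap.toMatrix' hg
        rwa [LinearMap.toMatrix'_comp, LinearMap.toMatrix'_toLin', LinearMap.toMatrix'_id] at this
      choose B hB using hB
      obtain ⟨i0, h0⟩ := hne
      apply h0
      have h1 : ∑ jm : (j : Fin d) → Fin (N j), (∏ l, B l (i0 l) (jm l)) *
          ∑ im : (j : Fin d) → Fin (n j), (∏ l, δ l (jm l) * A l (jm l) (im l)) * α im = 0 :=
        Finset.sum_eq_zero fun jm _ => by rw [hP, mul_zero]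
      simp_rw [Finset.mul_sum] at h1
      rw [Finset.sum_comm] at h1
      have h2 : ∀ im : (j : Fin d) → Fin (n j), ∑ jm : (j : Fin d) → Fin (N j),
          (∏ l, B l (i0 l) (jm l)) * ((∏ l, δ l (jm l) * A l (jm l) (im l)) * α im)
          = if i0 = im then α im else 0 := by
        intro im
        have h3 : ∏ l, (∑ j, B l (i0 l) j * (δ l j * A l j (im l)))
            = ∏ l, (if i0 l = im l then (1:ℂ) else 0) := by
          refine Finset.prod_congr rfl fun l _ => ?_
          have := congrFun (congrFun (hB l) (i0 l)) (im l)
          rw [Matrix.mul_apply, Matrix.one_apply] at this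
          exact this
        rw [Finset.prod_univ_sum, Fintype.piFinset_univ] at h3
        simp_rw [← mul_assoc (∏ l, B l (i0 l) _), ← Finset.prod_mul_distrib]
        rw [← Finset.sum_mul, h3]
        by_cases h : i0 = im
        · subst h; simp
        · rw [if_neg h]
          obtain ⟨l, hl⟩ := Function.ne_iff.1 h
          rw [Finset.prod_eq_zero (Finset.mem_univ l) (if_neg hl), zero_mul]
      simp_rw [h2] at h1
      simpa using h1
    · push Not at hinj
      obtain ⟨m, v, hv, hv0⟩ := hinj
      have hv' : ∀ j, ∑ i, δ m j * A m j i * v i = 0 := fun j => congrFun hv j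
      have hs : ∀ i, δ m (k m i) * v i = 0 := by
        intro i
        have := hv' (k m i)
        simpa [hA] using this
      obtain ⟨i0, h0⟩ := hne
      refine ⟨Function.update (fun l _ => 1) m v, ?_, ?_⟩
      · intro l
        by_cases hl : l = m
        · subst hl; simpa using hv0
        · rw [Function.update_of_ne hl]
          intro h
          simpa using congrFun h (i0 l)
      · intro jm
        rw [Finset.prod_eq_zero (Finset.mem_univ m), Finset.prod_eq_zero (Finset.mem_univ m)]
        · rw [Function.update_self]
          refine Finset.sum_eq_zero fun i _ => ?_
          linear_combination A m (jm m) i * hs i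
        · rw [Function.update_self]
          exact hv' _

/-- If the data tensor `𝔻` is nonzero of tensor rank 1 and some nonzero coefficient
tensor `α` satisfies `L_d vec(α) = 0`, then some nonzero rank-(at most)-1 tensor
`α̃` also satisfies `L_d vec(α̃) = 0`. -/
theorem rank_one_data_rank_one_kernel
    (d : ℕ) (hd : 1 ≤ d)
    (N n : Fin d → ℕ)
    (Z : (j : Fin d) → Fin (N j) → ℂ)
    (hZ : ∀ j, Function.Injective (Z j))
    (lam : (j : Fin d) → Fin (n j) → ℂ)
    (hlam : ∀ j, Function.Injective (lam j))
    (hsub : ∀ j i, ∃ k, lam j i = Z j k)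
    (f : (Fin d → ℂ) → ℂ)
    (D : ((j : Fin d) → Fin (N j)) → ℂ)
    (hD : ∀ jm, D jm = f (fun j => Z j (jm j)))
    (H : ((j : Fin d) → Fin (n j)) → ℂ)
    (hH : ∀ im, H im = f (fun j => lam j (im j)))
    -- 𝔻 has tensor rank one ...
    (δ : (j : Fin d) → Fin (N j) → ℂ)
    (hrank1 : ∀ jm : (j : Fin d) → Fin (N j), D jm = ∏ l, δ l (jm l))
    -- ... and is nonzero
    (hDne : ∃ jm : (j : Fin d) → Fin (N j), D jm ≠ 0)
    -- a nonzero coefficient tensor in the kernel of the higher-order Loewner matrix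
    (α : ((j : Fin d) → Fin (n j)) → ℂ)
    (hα : α ≠ 0)
    (hker : ∀ jm : (j : Fin d) → Fin (N j),
      ∑ im : (j : Fin d) → Fin (n j),
        (D jm - H im) * (∏ l, modCauchy (lam l) (Z l (jm l)) (im l)) * α im = 0) :
    ∃ a : (l : Fin d) → Fin (n l) → ℂ,
      (fun im : (j : Fin d) → Fin (n j) => ∏ l, a l (im l)) ≠ 0 ∧
      ∀ jm : (j : Fin d) → Fin (N j),
        ∑ im : (j : Fin d) → Fin (n j),
          (D jm - H im) * (∏ l, modCauchy (lam l) (Z l (jm l)) (im l)) *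
            (∏ l, a l (im l)) = 0 := by
  classical
  choose k hk using hsub
  have hHk : ∀ im : (j : Fin d) → Fin (n j), H im = ∏ l, δ l (k l (im l)) := by
    intro im
    rw [hH, ← hrank1 (fun l => k l (im l)), hD]
    congr 1
    funext j
    exact hk j (im j)
  have hA : ∀ l i i', modCauchy (lam l) (Z l (k l i)) i' = if i = i' then 1 else 0 := by
    intro l i i'
    unfold modCauchy
    rw [← hk]
    by_cases h : i = i'
    · simp [h]
    · have h' : lam l i ≠ lam l i' := fun e => h (hlam l e)
      rw [if_neg h', if_pos ⟨i, rfl⟩, if_neg h]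
  obtain ⟨a, ha, hka⟩ := rok_core (fun l j i => modCauchy (lam l) (Z l j) i) k hA δ hd α hα
    (by
      intro jm
      rw [← hker jm]
      exact Finset.sum_congr rfl fun im _ => by rw [hrank1, hHk])
  refine ⟨a, ?_, ?_⟩
  · have : ∀ l, ∃ i, a l i ≠ 0 := fun l => Function.ne_iff.1 (ha l)
    choose i hi using this
    intro h
    exact Finset.prod_ne_zero_iff.2 (fun l _ => hi l) (congrFun h i)
  · intro jm
    have h := hka jm
    rw [Finset.prod_univ_sum, Finset.prod_univ_sum, Fintype.piFinset_univ, ← sub_eq_zero,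
      ← Finset.sum_sub_distrib] at h
    rw [← h]
    refine Finset.sum_congr rfl fun im _ => ?_
    rw [hrank1, hHk]
    simp only [Finset.prod_mul_distrib]
    ring
end

section
/- There exist polynomials q⁽¹⁾_1, …, q⁽¹⁾_{r+1} and q⁽²⁾_1, …, q⁽²⁾_{r+1} in ℂ[X] such that for all (z₁, z₂) ∈ ℂ², det(K(z₁, z₂)) = Σ_{ℓ=1}^{r+1} q⁽¹⁾_ℓ(z₁) · q⁽²⁾_ℓ(z₂). Consequently, for every (z₁, z₂) with det(K(z₁, z₂)) ≠ 0, the function f(z₁, z₂) = cᵀ K(z₁, z₂)⁻¹ b satisfies f(z₁, z₂) = (cᵀ adj(K(z₁, z₂)) b) / det(K(z₁, z₂)), where adj denotes the adjugate matrix and cᵀ adj(K(z₁, z₂)) b is a polynomial function of (z₁, z₂); i.e., f is a ratio of two polynomials whose denominator det(K(z)) has separation rank at most r + 1. -/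
open Matrix

lemma rank_factor {m n : ℕ} (A : Matrix (Fin m) (Fin n) ℂ) :
    ∃ (P : Matrix (Fin m) (Fin A.rank) ℂ) (Q : Matrix (Fin A.rank) (Fin n) ℂ), A = P * Q := by
  let V := LinearMap.range A.mulVecLin
  have hd : Module.finrank ℂ V = A.rank := rfl
  let e : V ≃ₗ[ℂ] (Fin A.rank → ℂ) := (Module.finBasisOfFinrankEq ℂ V hd).equivFun
  let f : (Fin n → ℂ) →ₗ[ℂ] (Fin A.rank → ℂ) := e.toLinearMap ∘ₗ A.mulVecLin.rangeRestrict
  let g : (Fin A.rank → ℂ) →ₗ[ℂ] (Fin m → ℂ) := V.subtype ∘ₗ e.symm.toLinearMap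
  refine ⟨LinearMap.toMatrix' g, LinearMap.toMatrix' f, ?_⟩
  rw [← LinearMap.toMatrix'_comp]
  have : g ∘ₗ f = A.mulVecLin := by
    refine LinearMap.ext fun x => ?_
    simp [g, f]
  rw [this]
  exact (LinearMap.toMatrix'_toLin' A).symm

lemma det_factor {m₁ m₂ r : ℕ}
    (K11 : Matrix (Fin m₁) (Fin m₁) ℂ) (K22 : Matrix (Fin m₂) (Fin m₂) ℂ)
    (hK11 : IsUnit K11) (hK22 : IsUnit K22)
    (K12 : Matrix (Fin m₁) (Fin m₂) ℂ) (K21 : Matrix (Fin m₂) (Fin m₁) ℂ)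
    (P : Matrix (Fin m₂) (Fin r) ℂ) (Q : Matrix (Fin r) (Fin m₂) ℂ)
    (h : K22⁻¹ * K21 * K11⁻¹ * K12 = P * Q) (h1 : r ≤ m₁) (h2 : r ≤ m₂) (z₁ z₂ : ℂ) :
    (Matrix.fromBlocks (z₁ • K11) K12 K21 (z₂ • K22)).det =
      ∑ i : Fin (r + 1), z₁ ^ (m₁ - r + i) *
        (K11.det * K22.det * (Q * P).charpoly.coeff i * z₂ ^ (m₂ - r + i)) := by
  have hd1 : IsUnit K11.det := (Matrix.isUnit_iff_isUnit_det _).1 hK11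
  have hd2 : IsUnit K22.det := (Matrix.isUnit_iff_isUnit_det _).1 hK22
  have key : Set.EqOn (fun z : ℂ × ℂ => (Matrix.fromBlocks (z.1 • K11) K12 K21 (z.2 • K22)).det)
      (fun z : ℂ × ℂ => ∑ i : Fin (r + 1), z.1 ^ (m₁ - r + i) *
        (K11.det * K22.det * (Q * P).charpoly.coeff i * z.2 ^ (m₂ - r + i)))
      (({0}ᶜ : Set ℂ) ×ˢ ({0}ᶜ : Set ℂ)) := by
    rintro ⟨z₁, z₂⟩ ⟨hz1, hz2⟩
    simp only [Set.mem_compl_iff, Set.mem_singleton_iff] at hz1 hz2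
    dsimp only
    have hi : (z₁ • K11) * (z₁⁻¹ • K11⁻¹) = 1 := by
      simp [smul_smul, hz1, Matrix.mul_nonsing_inv _ hd1]
    let _ : Invertible (z₁ • K11) := ⟨z₁⁻¹ • K11⁻¹, mul_eq_one_comm.1 hi, hi⟩
    have hinv : ⅟(z₁ • K11) = z₁⁻¹ • K11⁻¹ := rfl
    rw [Matrix.det_fromBlocks₁₁, hinv]
    have e1 : z₂ • K22 - K21 * z₁⁻¹ • K11⁻¹ * K12
        = (z₂ • K22) * (1 - ((z₁ * z₂)⁻¹ • P) * Q) := by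
      rw [Matrix.smul_mul _ P Q, ← h]
      simp only [mul_sub, Matrix.mul_smul, Matrix.smul_mul, smul_smul, mul_one, ← Matrix.mul_assoc,
        Matrix.mul_nonsing_inv _ hd2, Matrix.one_mul]
      congr 2
      field_simp
    rw [e1, Matrix.det_mul, Matrix.det_one_sub_mul_comm, Matrix.det_smul, Matrix.det_smul]
    have e2 : (z₁ * z₂) ^ r * (1 - Q * ((z₁ * z₂)⁻¹ • P)).det
        = ∑ i : Fin (r + 1), (Q * P).charpoly.coeff i * (z₁ * z₂) ^ (i : ℕ) := by
      have : (Q * P).charpoly.natDegree = r := by simp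
      rw [Fin.sum_univ_eq_sum_range (fun i => (Q * P).charpoly.coeff i * (z₁ * z₂) ^ i) (r+1)]
      rw [← Polynomial.eval_eq_sum_range' (by omega), Matrix.eval_charpoly]
      have e3 : Matrix.scalar (Fin r) (z₁ * z₂) - Q * P
          = (z₁ * z₂) • (1 - Q * ((z₁ * z₂)⁻¹ • P)) := by
        rw [smul_sub, Matrix.mul_smul, smul_smul, mul_inv_cancel₀ (mul_ne_zero hz1 hz2), one_smul,
          Matrix.smul_one_eq_diagonal]
        rfl
      rw [e3, Matrix.det_smul, Fintype.card_fin]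
    have e4 : ∀ i : Fin (r + 1), z₁ ^ (m₁ - r + i) *
        (K11.det * K22.det * (Q * P).charpoly.coeff i * z₂ ^ (m₂ - r + i))
        = (z₁ ^ (m₁ - r) * z₂ ^ (m₂ - r) * K11.det * K22.det) *
          ((Q * P).charpoly.coeff i * (z₁ * z₂) ^ (i : ℕ)) := by
      intro i; ring
    rw [Finset.sum_congr rfl (fun i _ => e4 i), ← Finset.mul_sum, ← e2]
    simp only [Fintype.card_fin]
    have a1 : z₁ ^ m₁ = z₁ ^ (m₁ - r) * z₁ ^ r := by rw [← pow_add]; congr 1; omega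
    have a2 : z₂ ^ m₂ = z₂ ^ (m₂ - r) * z₂ ^ r := by rw [← pow_add]; congr 1; omega
    rw [a1, a2]; ring
  have hdense : Dense (({0}ᶜ : Set ℂ) ×ˢ ({0}ᶜ : Set ℂ)) :=
    (dense_compl_singleton 0).prod (dense_compl_singleton 0)
  have hc : Continuous
      (fun z : ℂ × ℂ => (Matrix.fromBlocks (z.1 • K11) K12 K21 (z.2 • K22)).det) := by
    apply Continuous.matrix_det
    apply Continuous.matrix_fromBlocks <;> fun_prop
  exact congrFun (Continuous.ext_on hdense hc (by fun_prop) key) (z₁, z₂)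


/-- The determinant of the parametrized block matrix `K(z₁,z₂)` is a sum of `r+1`
separable (polynomial) terms, where `r = min(rank K₁₂, rank K₂₁)`; consequently
`f(z₁,z₂) = cᵀ K(z₁,z₂)⁻¹ b` is a ratio of polynomial functions with denominator
`det K(z₁,z₂)` and numerator the polynomial function `cᵀ adj(K(z₁,z₂)) b`. -/
theorem det_blockMatrix_separation_rank
    (m₁ m₂ : ℕ) (hm₁ : 1 ≤ m₁) (hm₂ : 1 ≤ m₂)
    (K11 : Matrix (Fin m₁) (Fin m₁) ℂ) (K22 : Matrix (Fin m₂) (Fin m₂) ℂ)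
    (hK11 : IsUnit K11) (hK22 : IsUnit K22)
    (K12 : Matrix (Fin m₁) (Fin m₂) ℂ) (K21 : Matrix (Fin m₂) (Fin m₁) ℂ)
    (b c : Fin m₁ ⊕ Fin m₂ → ℂ)
    (K : ℂ → ℂ → Matrix (Fin m₁ ⊕ Fin m₂) (Fin m₁ ⊕ Fin m₂) ℂ)
    (hK : ∀ z₁ z₂, K z₁ z₂ = Matrix.fromBlocks (z₁ • K11) K12 K21 (z₂ • K22))
    (r : ℕ) (hr : r = min K12.rank K21.rank) :
    (∃ q₁ q₂ : Fin (r + 1) → Polynomial ℂ,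
      ∀ z₁ z₂ : ℂ,
        (K z₁ z₂).det = ∑ ℓ : Fin (r + 1), (q₁ ℓ).eval z₁ * (q₂ ℓ).eval z₂) ∧
    (∃ p : MvPolynomial (Fin 2) ℂ,
      ∀ z₁ z₂ : ℂ,
        c ⬝ᵥ ((K z₁ z₂).adjugate *ᵥ b) = MvPolynomial.eval ![z₁, z₂] p) ∧
    (∀ z₁ z₂ : ℂ, (K z₁ z₂).det ≠ 0 →
      c ⬝ᵥ ((K z₁ z₂)⁻¹ *ᵥ b) =
        (c ⬝ᵥ ((K z₁ z₂).adjugate *ᵥ b)) / (K z₁ z₂).det) := by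

  refine ⟨?_, ?_, ?_⟩
  · have h1 : r ≤ m₁ := by
      have := K12.rank_le_height
      omega
    have h2 : r ≤ m₂ := by
      have := K12.rank_le_width
      omega
    have hPQ : ∃ (P : Matrix (Fin m₂) (Fin r) ℂ) (Q : Matrix (Fin r) (Fin m₂) ℂ),
        K22⁻¹ * K21 * K11⁻¹ * K12 = P * Q := by
      rcases min_choice K12.rank K21.rank with h | h
      · rw [h] at hr
        subst hr
        obtain ⟨P, Q, hA⟩ := rank_factor K12
        refine ⟨K22⁻¹ * K21 * K11⁻¹ * P, Q, ?_⟩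
        rw [Matrix.mul_assoc _ P Q, ← hA]
      · rw [h] at hr
        subst hr
        obtain ⟨P, Q, hA⟩ := rank_factor K21
        refine ⟨K22⁻¹ * P, Q * K11⁻¹ * K12, ?_⟩
        calc _ = K22⁻¹ * (P * Q) * K11⁻¹ * K12 := by rw [← hA]
          _ = _ := by simp only [Matrix.mul_assoc]
    obtain ⟨P, Q, h⟩ := hPQ
    refine ⟨fun i => Polynomial.X ^ (m₁ - r + i),
      fun i => Polynomial.C (K11.det * K22.det * (Q * P).charpoly.coeff i) *
        Polynomial.X ^ (m₂ - r + i), fun z₁ z₂ => ?_⟩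
    rw [hK, det_factor K11 K22 hK11 hK22 K12 K21 P Q h h1 h2]
    simp only [Polynomial.eval_pow, Polynomial.eval_X, Polynomial.eval_mul, Polynomial.eval_C]
  · let Cst : ℂ →+* MvPolynomial (Fin 2) ℂ := MvPolynomial.C
    let KK : Matrix (Fin m₁ ⊕ Fin m₂) (Fin m₁ ⊕ Fin m₂) (MvPolynomial (Fin 2) ℂ) :=
      Matrix.fromBlocks ((MvPolynomial.X 0 : MvPolynomial (Fin 2) ℂ) • K11.map Cst) (K12.map Cst)
        (K21.map Cst) ((MvPolynomial.X 1 : MvPolynomial (Fin 2) ℂ) • K22.map Cst)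
    refine ⟨∑ i, Cst (c i) * ∑ j, KK.adjugate i j * Cst (b j), fun z₁ z₂ => ?_⟩
    have hmap : (MvPolynomial.eval ![z₁, z₂]).mapMatrix KK = K z₁ z₂ := by
      rw [hK]
      ext i j
      rcases i with i | i <;> rcases j with j | j <;> simp [KK, Cst]
    rw [← hmap, ← RingHom.map_adjugate]
    simp [dotProduct, mulVec, Cst]
  · intro z₁ z₂ hz
    rw [Matrix.inv_def, Ring.inverse_eq_inv', Matrix.smul_mulVec, dotProduct_smul, smul_eq_mul,
      div_eq_inv_mul]
end

section
/- Suppose in addition that r ≤ min(m₁, m₂) and that W, Y ∈ ℂ^{m₁×r} satisfy K₁₂ K₂₂⁻¹ K₂₁ = W Yᵀ. Then for all z₁, z₂ ∈ ℂ with z₁ ≠ 0 and z₂ ≠ 0, det(K(z₁, z₂)) = det(K₁₁) · det(K₂₂) · z₁^{m₁−r} · z₂^{m₂−r} · det(z₁ z₂ · I_r − Yᵀ K₁₁⁻¹ W). -/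
open Matrix

/-- Determinant formula for the parametrized block matrix via the low-rank update
`K₁₂ K₂₂⁻¹ K₂₁ = W Yᵀ`:
`det K(z₁,z₂) = det K₁₁ · det K₂₂ · z₁^(m₁−r) · z₂^(m₂−r) · det(z₁z₂ I_r − Yᵀ K₁₁⁻¹ W)`. -/
theorem det_blockMatrix_lowRankUpdate
    (m₁ m₂ r : ℕ) (hm₁ : 1 ≤ m₁) (hm₂ : 1 ≤ m₂)
    (K11 : Matrix (Fin m₁) (Fin m₁) ℂ) (K22 : Matrix (Fin m₂) (Fin m₂) ℂ)
    (hK11 : IsUnit K11) (hK22 : IsUnit K22)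
    (K12 : Matrix (Fin m₁) (Fin m₂) ℂ) (K21 : Matrix (Fin m₂) (Fin m₁) ℂ)
    (hr₁ : r ≤ m₁) (hr₂ : r ≤ m₂)
    (W Y : Matrix (Fin m₁) (Fin r) ℂ)
    (hWY : K12 * K22⁻¹ * K21 = W * Yᵀ)
    (z₁ z₂ : ℂ) (hz₁ : z₁ ≠ 0) (hz₂ : z₂ ≠ 0) :
    (Matrix.fromBlocks (z₁ • K11) K12 K21 (z₂ • K22)).det =
      K11.det * K22.det * z₁ ^ (m₁ - r) * z₂ ^ (m₂ - r) *
        ((z₁ * z₂) • (1 : Matrix (Fin r) (Fin r) ℂ) - Yᵀ * K11⁻¹ * W).det := by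
  have h11 : IsUnit K11.det := (Matrix.isUnit_iff_isUnit_det _).1 hK11
  have h22 : IsUnit K22.det := (Matrix.isUnit_iff_isUnit_det _).1 hK22
  have hz : z₁ * z₂ ≠ 0 := mul_ne_zero hz₁ hz₂
  have hR : (z₂ • K22) * (z₂⁻¹ • K22⁻¹) = 1 := by
    rw [Matrix.smul_mul, Matrix.mul_smul, smul_smul, Matrix.mul_nonsing_inv _ h22,
      mul_inv_cancel₀ hz₂, one_smul]
  let _ : Invertible (z₂ • K22) := ⟨z₂⁻¹ • K22⁻¹, mul_eq_one_comm.1 hR, hR⟩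
  have hinv : ⅟(z₂ • K22) = z₂⁻¹ • K22⁻¹ := rfl
  have e1 : z₁ • K11 - K12 * ⅟(z₂ • K22) * K21
      = (z₁ • K11) * (1 - (K11⁻¹ * W) * ((z₁ * z₂)⁻¹ • Yᵀ)) := by
    rw [hinv, Matrix.mul_smul, Matrix.smul_mul, hWY, Matrix.mul_sub, Matrix.mul_one,
      Matrix.mul_smul, Matrix.smul_mul, Matrix.mul_smul, smul_smul, Matrix.mul_assoc,
      ← Matrix.mul_assoc K11, Matrix.mul_nonsing_inv _ h11, Matrix.one_mul]
    congr 2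
    field_simp
  have e2 : (z₁ * z₂) • (1 : Matrix (Fin r) (Fin r) ℂ) - Yᵀ * K11⁻¹ * W
      = (z₁ * z₂) • (1 - ((z₁ * z₂)⁻¹ • Yᵀ) * (K11⁻¹ * W)) := by
    rw [smul_sub, Matrix.smul_mul, smul_smul, mul_inv_cancel₀ hz, one_smul, Matrix.mul_assoc]
  rw [Matrix.det_fromBlocks₂₂, e1, e2, Matrix.det_mul, Matrix.det_one_sub_mul_comm,
    Matrix.det_smul, Matrix.det_smul, Matrix.det_smul]
  simp only [Fintype.card_fin]
  obtain ⟨a, rfl⟩ := Nat.exists_eq_add_of_le hr₁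
  obtain ⟨b, rfl⟩ := Nat.exists_eq_add_of_le hr₂
  simp only [Nat.add_sub_cancel_left]
  ring
end
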